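/- Fix real p > 0 and real α > 1, and for q > 0 set t(q) := p^{−1/(1+α)} · q^{−α/(1+α)}. Then the ratio f1D(t(q);p,q/2) / f1D(t(q);p,q) tends to 1/2 as q → ∞. -/

import Mathlib

open Filter

/-- The Bass adoption level on the infinite line. -/
noncomputable def f1D (t p q : ℝ) : ℝ :=
  1 - Real.exp (-(p + q) * t + (q / p) * (1 - Real.exp (-p * t)))

/-- Second-order Taylor expansion of `exp` at `0`, as the limit of a quotient. -/
theorem tendsto_exp_sub_one_sub_id_div_sq :
    Tendsto (fun x : ℝ => (Real.exp x - 1 - x) / x ^ 2) (nhdsWithin 0 {0}ᶜ) (nhds (1 / 2)) := by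
  have h := ((Real.exp_sub_sum_range_succ_isLittleO_pow 2).tendsto_div_nhds_zero.mono_left
    (nhdsWithin_le_nhds (s := {0}ᶜ))).add_const (1 / 2)
  rw [zero_add] at h
  refine h.congr' ?_
  filter_upwards [self_mem_nhdsWithin] with x hx
  have hx : x ≠ 0 := hx
  simp only [Finset.sum_range_succ, Finset.sum_range_zero, Nat.factorial]
  push_cast
  field_simp
  ring

theorem tendsto_one_sub_exp_neg_div :
    Tendsto (fun x : ℝ => (1 - Real.exp (-x)) / x) (nhdsWithin 0 {0}ᶜ) (nhds 1) := by
  have h : HasDerivAt (fun x : ℝ => 1 - Real.exp (-x)) 1 0 := by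
    simpa using ((hasDerivAt_neg (0 : ℝ)).exp).const_sub 1
  refine (hasDerivAt_iff_tendsto_slope_zero.mp h).congr fun x => ?_
  simp [div_eq_inv_mul]

/-- If `t → 0⁺`, `q t → ∞` and `q t² → 0`, then `f1D t p q` is asymptotic to `(p / 2) q t²`. -/
theorem tendsto_f1D_div_mul_sq {ι : Type*} {l : Filter ι} {p : ℝ} (hp : 0 < p) {t q : ι → ℝ}
    (ht : Tendsto t l (nhds 0)) (ht0 : ∀ᶠ i in l, 0 < t i)
    (hqt : Tendsto (fun i => q i * t i) l atTop)
    (hqt2 : Tendsto (fun i => q i * t i ^ 2) l (nhds 0)) :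
    Tendsto (fun i => f1D (t i) p (q i) / (q i * t i ^ 2)) l (nhds (p / 2)) := by
  set e : ι → ℝ := fun i => (p + q i) * t i - q i / p * (1 - Real.exp (-p * t i)) with he
  have hpt : Tendsto (fun i => -p * t i) l (nhdsWithin 0 {0}ᶜ) := by
    refine tendsto_nhdsWithin_iff.mpr ⟨by simpa using ht.const_mul (-p), ?_⟩
    filter_upwards [ht0] with i hi
    exact mul_ne_zero (neg_ne_zero.mpr hp.ne') hi.ne'
  have hq0 : ∀ᶠ i in l, 0 < q i := by
    filter_upwards [ht0, hqt.eventually_gt_atTop 0] with i hi h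
    exact pos_of_mul_pos_left h hi.le
  have hratio : Tendsto (fun i => e i / (q i * t i ^ 2)) l (nhds (p / 2)) := by
    have h := (hqt.const_div_atTop p).add
      ((tendsto_exp_sub_one_sub_id_div_sq.comp hpt).const_mul p)
    rw [show 0 + p * (1 / 2) = p / 2 by ring] at h
    refine h.congr' ?_
    filter_upwards [ht0, hq0] with i hi hqi
    simp only [he, Function.comp]
    generalize Real.exp (-p * t i) = y
    field_simp
    ring
  have he0 : Tendsto e l (nhdsWithin 0 {0}ᶜ) := by
    refine tendsto_nhdsWithin_iff.mpr ⟨?_, ?_⟩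
    · have h := hratio.mul hqt2
      rw [mul_zero] at h
      refine h.congr' ?_
      filter_upwards [ht0, hq0] with i hi hqi
      exact div_mul_cancel₀ _ (by positivity)
    · filter_upwards [hratio.eventually_ne (half_pos hp).ne'] with i hi h
      exact hi (by rw [show e i = 0 from h, zero_div])
  have h := (tendsto_one_sub_exp_neg_div.comp he0).mul hratio
  rw [one_mul] at h
  refine h.congr' ?_
  filter_upwards [he0.eventually self_mem_nhdsWithin] with i hi
  have hi : e i ≠ 0 := hi
  simp only [Function.comp]
  rw [div_mul_div_cancel₀ hi, f1D]
  congr 3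
  simp only [he]
  ring

/-- Along the time scale `t(q) = p^{−1/(1+α)}·q^{−α/(1+α)}` (`α > 1`), the ratio
`f1D(t(q);p,q/2) / f1D(t(q);p,q)` tends to `1/2` as `q → ∞`. -/
theorem ratio_tendsto_half_along_talpha (p α : ℝ) (hp : 0 < p) (hα : 1 < α) :
    Tendsto
      (fun q : ℝ =>
        f1D (p ^ (-(1 / (1 + α))) * q ^ (-(α / (1 + α)))) p (q / 2) /
          f1D (p ^ (-(1 / (1 + α))) * q ^ (-(α / (1 + α)))) p q)
      atTop (nhds (1 / 2)) := by
  have hα1 : 0 < 1 + α := by linarith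
  set c : ℝ := p ^ (-(1 / (1 + α))) with hc
  have hc0 : 0 < c := Real.rpow_pos_of_pos hp _
  set t : ℝ → ℝ := fun q => c * q ^ (-(α / (1 + α))) with htdef
  have ht : Tendsto t atTop (nhds 0) := by
    simpa using (tendsto_rpow_neg_atTop (y := α / (1 + α)) (by positivity)).const_mul c
  have ht0 : ∀ᶠ q in atTop, 0 < t q := by
    filter_upwards [eventually_gt_atTop 0] with q hq
    exact mul_pos hc0 (Real.rpow_pos_of_pos hq _)
  have hqt : Tendsto (fun q => q * t q) atTop atTop := by
    refine ((tendsto_rpow_atTop (y := 1 / (1 + α)) (by positivity)).const_mul_atTop hc0).congr' ?_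
    filter_upwards [eventually_gt_atTop 0] with q hq
    rw [show 1 / (1 + α) = 1 + -(α / (1 + α)) by field_simp; ring, Real.rpow_add hq,
      Real.rpow_one]
    simp only [htdef]
    ring
  have hqt2 : Tendsto (fun q => q * t q ^ 2) atTop (nhds 0) := by
    have h := (tendsto_rpow_neg_atTop (y := (α - 1) / (1 + α))
      (div_pos (by linarith) hα1)).const_mul (c ^ 2)
    rw [mul_zero] at h
    refine h.congr' ?_
    filter_upwards [eventually_gt_atTop 0] with q hq
    rw [show -((α - 1) / (1 + α)) = 1 + -(α / (1 + α)) + -(α / (1 + α)) by field_simp; ring,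
      Real.rpow_add hq, Real.rpow_add hq, Real.rpow_one]
    simp only [htdef]
    ring
  have hfull := tendsto_f1D_div_mul_sq hp ht ht0 hqt hqt2
  have hhalf := tendsto_f1D_div_mul_sq (q := fun q => q / 2) hp ht ht0
    ((hqt.atTop_div_const two_pos).congr fun q => by ring)
    (by simpa [div_mul_eq_mul_div] using hqt2.div_const 2)
  have h := (hhalf.div hfull (half_pos hp).ne').const_mul (1 / 2)
  rw [div_self (half_pos hp).ne', mul_one] at h
  refine h.congr' ?_
  filter_upwards [ht0, eventually_gt_atTop 0] with q htq hq
  change 1 / 2 * (f1D (t q) p (q / 2) / (q / 2 * t q ^ 2) / (f1D (t q) p q / (q * t q ^ 2))) =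
    f1D (t q) p (q / 2) / f1D (t q) p q
  field_simp
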